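/- Let V be a finite-dimensional complex vector space of dimension n, and work in the exterior algebra Λ(V*) of the dual space. For v ∈ V let ι_v : Λ(V*) → Λ(V*) denote the contraction (interior product) by v, let rev denote the canonical anti-automorphism of Λ(V*), which acts on the degree-k component Λ^k(V*) by the scalar (−1)^{k(k−1)/2}, and let π_n : Λ(V*) → Λ^n(V*) denote the projection onto the top-degree graded component. Given finitely many vectors v_1, w_1, …, v_m, w_m ∈ V, set I := Σ_{k=1}^m ι_{v_k} ∘ ι_{w_k} (the contraction by the bivector σ = Σ_k v_k ∧ w_k); the operator I lowers degree by 2, hence is nilpotent, so exp(I) is a finite sum. Then for all α, β ∈ Λ(V*): π_n( rev(exp(I)α) ∧ exp(I)β ) = π_n( rev(α) ∧ β ). -/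

import Mathlib

open scoped TensorProduct

section Helpers
open CliffordAlgebra
variable {W : Type*} [AddCommGroup W] [Module ℂ W]


theorem cl_mul (d : Module.Dual ℂ W) (a b : ExteriorAlgebra ℂ W) :
    contractLeft d (a * b) = contractLeft d a * b + involute a * contractLeft d b := by
  induction a using CliffordAlgebra.left_induction with
  | algebraMap r => simp [contractLeft_algebraMap_mul, contractLeft_algebraMap]
  | add x y hx hy => simp only [add_mul, map_add, hx, hy]; abel
  | ι_mul x m hx =>
    rw [mul_assoc, contractLeft_ι_mul, contractLeft_ι_mul, hx]
    simp only [map_mul, involute_ι, mul_add, sub_mul, smul_mul_assoc, neg_mul, mul_assoc]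
    abel

theorem rev_cl (d : Module.Dual ℂ W) (a : ExteriorAlgebra ℂ W) :
    reverse (contractLeft d a) = - contractLeft d (involute (reverse a)) := by
  induction a using CliffordAlgebra.left_induction with
  | algebraMap r => simp [contractLeft_algebraMap]
  | add x y hx hy => simp only [map_add, hx, hy]; abel
  | ι_mul x m hx =>
    rw [contractLeft_ι_mul, map_sub, reverse.map_mul, reverse.map_mul, reverse_ι, hx, map_mul,
      cl_mul]
    simp [involute_involute, contractLeft_ι, Algebra.smul_def, (Algebra.commutes _ _).symm]

theorem cl_mem (d : Module.Dual ℂ W) (k : ℕ) (x : ExteriorAlgebra ℂ W) (hx : x ∈ ⋀[ℂ]^k W) :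
    contractLeft d x ∈ ⋀[ℂ]^(k-1) W ∧ (k = 0 → contractLeft d x = 0) := by
  induction k generalizing x with
  | zero =>
    simp [Submodule.mem_one] at hx ⊢
    obtain ⟨r, rfl⟩ := hx
    have := contractLeft_algebraMap (Q := (0 : QuadraticForm ℂ W)) d r
    exact ⟨⟨0, by rw [map_zero]; exact this.symm⟩, this⟩
  | succ k ih =>
    refine ⟨?_, by simp⟩
    simp only [pow_succ'] at hx
    induction hx using Submodule.mul_induction_on' with
    | add x _ y _ hx hy => rw [map_add]; exact add_mem hx hy
    | mem_mul_mem m hm n hn =>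
      obtain ⟨m, rfl⟩ := hm
      have := contractLeft_ι_mul (Q := (0 : QuadraticForm ℂ W)) d m n
      erw [this]
      simp only [Nat.add_sub_cancel]
      refine sub_mem (Submodule.smul_mem _ _ hn) ?_
      rcases k with _ | k
      · erw [(ih n hn).2 rfl]; simp
      · have h1 := (ih n hn).1
        simp only [pow_succ']
        exact Submodule.mul_mem_mul ⟨m, rfl⟩ h1

theorem ext_zero [FiniteDimensional ℂ W] (k : ℕ) (hk : Module.finrank ℂ W < k) (x) (hx : x ∈ ⋀[ℂ]^k W) : x = 0 := by
  have : Module.finrank ℂ (⋀[ℂ]^k W) = 0 := by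
    rw [exteriorPower.finrank_eq, Nat.choose_eq_zero_of_lt hk]
  have := Module.finrank_zero_iff.1 this
  exact congrArg Subtype.val (Subsingleton.elim (⟨x, hx⟩ : ⋀[ℂ]^k W) 0)

theorem proj_cl [FiniteDimensional ℂ W] (d : Module.Dual ℂ W) (x : ExteriorAlgebra ℂ W) :
    GradedAlgebra.proj (fun i : ℕ => ⋀[ℂ]^i W) (Module.finrank ℂ W) (contractLeft d x) = 0 := by
  classical
  induction x using DirectSum.Decomposition.inductionOn (fun i : ℕ => ⋀[ℂ]^i W) with
  | zero => simp
  | add x y hx hy => rw [map_add, map_add, hx, hy, add_zero]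
  | @homogeneous k x =>
    obtain ⟨x, hx⟩ := x
    have h := cl_mem d k x hx
    by_cases h0 : k = 0
    · simp only [h.2 h0, map_zero]
    by_cases hk : k - 1 = Module.finrank ℂ W
    · have : x = 0 := ext_zero k (by omega) x hx
      subst this
      simp only [map_zero]
    · rw [GradedAlgebra.proj_apply]
      exact DirectSum.decompose_of_mem_ne (fun i : ℕ => ⋀[ℂ]^i W) h.1 hk

theorem pair_cl [FiniteDimensional ℂ W] (d : Module.Dual ℂ W) (a b : ExteriorAlgebra ℂ W) :
    GradedAlgebra.proj (fun i : ℕ => ⋀[ℂ]^i W) (Module.finrank ℂ W)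
      (reverse (contractLeft d a) * b) =
    GradedAlgebra.proj (fun i : ℕ => ⋀[ℂ]^i W) (Module.finrank ℂ W)
      (reverse a * contractLeft d b) := by
  have h := proj_cl d (involute (reverse a) * b)
  rw [cl_mul, involute_involute, map_add] at h
  rw [rev_cl, neg_mul, map_neg]
  exact neg_eq_of_add_eq_zero_right h

theorem sum_pow_zero {V : Type*} [AddCommGroup V] [Module ℂ V] [FiniteDimensional ℂ V]
    (m : ℕ) (v w : Fin m → V) :
    (∑ k, (contractLeft (Module.Dual.eval ℂ V (v k)) *
      contractLeft (Module.Dual.eval ℂ V (w k)) :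
        Module.End ℂ (ExteriorAlgebra ℂ (Module.Dual ℂ V)))) ^ (Module.finrank ℂ V + 1) = 0 := by
  let f : V →ₗ[ℂ] Module.End ℂ (ExteriorAlgebra ℂ (Module.Dual ℂ V)) :=
    contractLeft ∘ₗ Module.Dual.eval ℂ V
  let F := ExteriorAlgebra.lift ℂ ⟨f, fun x => LinearMap.ext fun y =>
    contractLeft_contractLeft _ _⟩
  let s : ExteriorAlgebra ℂ V := ∑ k, ExteriorAlgebra.ι ℂ (v k) * ExteriorAlgebra.ι ℂ (w k)
  have hs : s ∈ ⋀[ℂ]^2 V := by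
    refine Submodule.sum_mem _ fun k _ => ?_
    simp only [pow_two]
    exact Submodule.mul_mem_mul ⟨_, rfl⟩ ⟨_, rfl⟩
  have hF : F s = ∑ k, f (v k) * f (w k) := by
    simp only [s, F, map_sum, map_mul, ExteriorAlgebra.lift_ι_apply]
  have h0 : s ^ (Module.finrank ℂ V + 1) = 0 := by
    refine ext_zero (2 * (Module.finrank ℂ V + 1)) (by omega) _ ?_
    have := Submodule.pow_mem_pow _ hs (Module.finrank ℂ V + 1)
    rwa [← pow_mul] at this
  change (∑ k, f (v k) * f (w k)) ^ _ = 0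
  rw [← hF, ← map_pow, h0, map_zero]

theorem exp_pair {A M : Type*} [Ring A] [Algebra ℂ A] [AddCommGroup M] [Module ℂ M]
    (T : Module.End ℂ A) (N : ℕ) (hT : T ^ N = 0) (P : A →ₗ[ℂ] A →ₗ[ℂ] M)
    (h : ∀ a b, P (T a) b = - P a (T b)) (a b : A) :
    P ((∑ i ∈ Finset.range N, ((i.factorial : ℂ)⁻¹) • T ^ i) a)
      ((∑ i ∈ Finset.range N, ((i.factorial : ℂ)⁻¹) • T ^ i) b) = P a b := by
  let _ : Module ℚ (Module.End ℂ A) := Module.compHom _ (algebraMap ℚ ℂ)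
  have hsm : ∀ (i : ℕ) (S : Module.End ℂ A),
      ((i.factorial : ℚ)⁻¹) • S = ((i.factorial : ℂ)⁻¹) • S := by
    intro i S
    change (algebraMap ℚ ℂ ((i.factorial : ℚ)⁻¹)) • S = _
    simp
  have e1 := IsNilpotent.exp_eq_sum hT
  have hT' : (-T) ^ N = 0 := (neg_pow T N).trans (by rw [hT, mul_zero])
  have e2 := IsNilpotent.exp_eq_sum hT'
  have e3 := IsNilpotent.exp_neg_mul_exp_self (a := T) ⟨N, hT⟩
  simp only [hsm] at e1 e2
  have hp : ∀ (i : ℕ) (x y : A), P ((T ^ i) x) y = P x (((-T) ^ i) y) := by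
    intro i
    induction i with
    | zero => simp
    | succ i ih =>
      intro x y
      rw [pow_succ, pow_succ', Module.End.mul_apply, Module.End.mul_apply, ih, h,
        LinearMap.neg_apply, map_neg]
  have adj : ∀ x y, P ((∑ i ∈ Finset.range N, ((i.factorial : ℂ)⁻¹) • T ^ i) x) y =
      P x ((∑ i ∈ Finset.range N, ((i.factorial : ℂ)⁻¹) • (-T) ^ i) y) := by
    intro x y
    simp only [LinearMap.sum_apply, LinearMap.smul_apply, map_sum, map_smul, hp]
  rw [adj, ← Module.End.mul_apply, ← e1, ← e2, e3, Module.End.one_apply]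

end Helpers

/-- **Invariance of the Chevalley–Mukai pairing under the exponential of a contraction.**
Let `V` be a finite-dimensional complex vector space, `n = dim V`, and work in the exterior
algebra `Λ(V*)`.  For vectors `v₁, w₁, …, v_m, w_m ∈ V` let
`I = Σ_k ι_{v_k} ∘ ι_{w_k}` be the contraction by the bivector `σ = Σ_k v_k ∧ w_k`;
it lowers degree by `2`, hence `I ^ (n+1) = 0` and the finite exponential series for
`exp(I)` truncates at order `n`.  With `rev` the canonical anti-automorphism (reversal)
and `π_n` the projection onto the top-degree component `Λⁿ(V*)`, one has, for all
`α, β ∈ Λ(V*)`: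
`π_n( rev(exp(I)α) ∧ exp(I)β ) = π_n( rev(α) ∧ β )`. -/
theorem mukai_pairing_invariant_under_exp_contraction
    {V : Type*} [AddCommGroup V] [Module ℂ V] [FiniteDimensional ℂ V]
    (m : ℕ) (v w : Fin m → V) :
    ∀ α β : ExteriorAlgebra ℂ (Module.Dual ℂ V),
      letI W := Module.Dual ℂ V
      letI n := Module.finrank ℂ V
      letI ιc : V → Module.End ℂ (ExteriorAlgebra ℂ W) :=
        fun x => CliffordAlgebra.contractLeft (Module.Dual.eval ℂ V x)
      letI I : Module.End ℂ (ExteriorAlgebra ℂ W) := ∑ k, ιc (v k) * ιc (w k)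
      letI expI : Module.End ℂ (ExteriorAlgebra ℂ W) :=
        ∑ i ∈ Finset.range (n + 1), ((i.factorial : ℂ)⁻¹) • I ^ i
      letI rev : ExteriorAlgebra ℂ W →ₗ[ℂ] ExteriorAlgebra ℂ W := CliffordAlgebra.reverse
      letI π : ExteriorAlgebra ℂ W →ₗ[ℂ] ExteriorAlgebra ℂ W :=
        GradedAlgebra.proj (fun i : ℕ => ⋀[ℂ]^i W) n
      π (rev (expI α) * expI β) = π (rev α * β) := by
  intro α β
  have hn : Module.finrank ℂ (Module.Dual ℂ V) = Module.finrank ℂ V :=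
    Subspace.dual_finrank_eq
  let W := Module.Dual ℂ V
  let P : ExteriorAlgebra ℂ W →ₗ[ℂ] ExteriorAlgebra ℂ W →ₗ[ℂ] ExteriorAlgebra ℂ W :=
    ((LinearMap.mul ℂ (ExteriorAlgebra ℂ W)).compr₂
      (GradedAlgebra.proj (fun i : ℕ => ⋀[ℂ]^i W) (Module.finrank ℂ V))).comp
      CliffordAlgebra.reverse
  have hP : ∀ (x : V) (a b : ExteriorAlgebra ℂ W),
      P (CliffordAlgebra.contractLeft (Module.Dual.eval ℂ V x) a) b =
        P a (CliffordAlgebra.contractLeft (Module.Dual.eval ℂ V x) b) := by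
    intro x a b
    have := pair_cl (Module.Dual.eval ℂ V x) a b
    rw [hn] at this
    exact this
  refine exp_pair _ _ (sum_pow_zero m v w) P ?_ α β
  intro a b
  simp only [LinearMap.sum_apply, map_sum, Module.End.mul_apply, hP, ← Finset.sum_neg_distrib]
  refine Finset.sum_congr rfl fun k _ => ?_
  rw [CliffordAlgebra.contractLeft_comm, map_neg]
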